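/- arXiv:1910.10823 — 3 statements merged into one kernel-verified Lean document; each statement's English description precedes it below -/
import Mathlib

section
/- Let q be a fixed prime power. For each n ≥ 1 let P_n be the uniform probability measure on the set of transvections in GL_{2n}(F_q) that do not lie in Sp_{2n}(F_q), let D_n be the uniform probability measure on the set {diag(α,1,...,1) : α ∈ F_q^*} of diagonal matrices, and let U_n be the uniform probability measure on GL_{2n}(F_q). Then there exist constants A, B > 0 and an integer N such that for all n ≥ N and all integers c with 0 ≤ c ≤ n, the total variation distance ‖P_n^{*(n−c)} * D_n − U_n‖ is at least 1 − A·e^{−Bc}. -/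
open Matrix

noncomputable section

variable (F : Type) [Field F] [Fintype F] [DecidableEq F]

/-- The Gram matrix `J = [[0, I], [-I, 0]]` of the standard symplectic form on `F^(2n)`. -/
def Jmat (n : ℕ) : Matrix (Fin (2 * n)) (Fin (2 * n)) F :=
  Matrix.of fun i j =>
    if (j : ℕ) = (i : ℕ) + n then 1 else if (i : ℕ) = (j : ℕ) + n then -1 else 0

/-- `g ∈ GL_m(F)` is a transvection: `g ≠ I`, `rank (g - I) = 1` and `(g - I)^2 = 0`. -/
def IsTransvection {m : ℕ} (g : GL (Fin m) F) : Prop :=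
  g ≠ 1 ∧ ((g : Matrix (Fin m) (Fin m) F) - 1).rank = 1 ∧
    ((g : Matrix (Fin m) (Fin m) F) - 1) ^ 2 = 0

/-- Membership in the symplectic group `Sp_{2n}(F)`: `gᵀ J g = J`. -/
def InSp {n : ℕ} (g : GL (Fin (2 * n)) F) : Prop :=
  (g : Matrix (Fin (2 * n)) (Fin (2 * n)) F)ᵀ * Jmat F n *
    (g : Matrix (Fin (2 * n)) (Fin (2 * n)) F) = Jmat F n

open Classical in
/-- The uniform probability measure on a subset `S` of `G`. -/
def uniformOn {G : Type} (S : Set G) : G → ℝ :=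
  fun g => if g ∈ S then (Nat.card S : ℝ)⁻¹ else 0

/-- Convolution of two measures on a finite group:
`(μ * ν)(g) = ∑ h, μ(h) ν(h⁻¹ g)`. -/
def conv {G : Type} [Group G] [Fintype G] (μ ν : G → ℝ) : G → ℝ :=
  fun g => ∑ h : G, μ h * ν (h⁻¹ * g)

open Classical in
/-- `k`-fold convolution power of `μ`; the `0`-th power is the point mass at the identity. -/
def convPow {G : Type} [Group G] [Fintype G] (μ : G → ℝ) : ℕ → G → ℝ
  | 0 => fun g => if g = 1 then 1 else 0
  | k + 1 => conv (convPow μ k) μ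

/-- Total variation distance between two measures on a finite set. -/
def tvDist {G : Type} [Fintype G] (μ ν : G → ℝ) : ℝ :=
  2⁻¹ * ∑ g : G, |μ g - ν g|

/-- `P_n`: the uniform measure on the set of transvections in `GL_{2n}(F_q)` that do not lie
in `Sp_{2n}(F_q)`. -/
def Pmeas (n : ℕ) : GL (Fin (2 * n)) F → ℝ :=
  uniformOn {g | IsTransvection F g ∧ ¬ InSp F g}

/-- `D_n`: the uniform measure on the set of matrices `diag(α, 1, ..., 1)` for `α ∈ F^*`. -/
def Dmeas (n : ℕ) : GL (Fin (2 * n)) F → ℝ :=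
  uniformOn {g | ∃ α : Fˣ, (g : Matrix (Fin (2 * n)) (Fin (2 * n)) F) =
    Matrix.diagonal fun i : Fin (2 * n) => if (i : ℕ) = 0 then (α : F) else 1}

/-- `U_n`: the uniform measure on `GL_{2n}(F_q)`. -/
def Umeas (n : ℕ) : GL (Fin (2 * n)) F → ℝ :=
  uniformOn (Set.univ : Set (GL (Fin (2 * n)) F))

section Measures

variable {G : Type}

open Finset

lemma sum_uniformOn [Fintype G] {S : Set G} (hS : S.Nonempty) : ∑ g : G, uniformOn S g = 1 := by
  classical
  have hc : (Nat.card S : ℝ) ≠ 0 := by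
    have : Nonempty S := hS.to_subtype
    exact_mod_cast Nat.card_pos.ne'
  have hf : #{g : G | g ∈ S} = Nat.card S := by
    rw [Nat.card_eq_fintype_card, Fintype.card_subtype]
  simp only [uniformOn]
  rw [← Finset.sum_filter, Finset.sum_const, nsmul_eq_mul]
  convert mul_inv_cancel₀ hc using 2
  rw [← hf]

lemma sum_conv [Group G] [Fintype G] (μ ν : G → ℝ) : ∑ g, conv μ ν g = (∑ g, μ g) * ∑ g, ν g := by
  simp only [conv]
  rw [Finset.sum_comm, Finset.sum_mul]
  refine Finset.sum_congr rfl fun h _ => ?_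
  rw [← Finset.mul_sum]
  congr 1
  exact Equiv.sum_comp (Equiv.mulLeft h⁻¹) ν

lemma sum_convPow [Group G] [Fintype G] {μ : G → ℝ} (hμ : ∑ g, μ g = 1) (k : ℕ) : ∑ g, convPow μ k g = 1 := by
  induction k with
  | zero => simpa [convPow] using Finset.card_eq_one.mpr ⟨1, by ext; simp⟩
  | succ k ih => rw [convPow, sum_conv, ih, hμ, one_mul]

lemma exists_mul_eq_of_conv_ne_zero [Group G] [Fintype G] {μ ν : G → ℝ} {g : G} (h : conv μ ν g ≠ 0) :
    ∃ a b, a * b = g ∧ μ a ≠ 0 ∧ ν b ≠ 0 := by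
  obtain ⟨a, -, ha⟩ := Finset.exists_ne_zero_of_sum_ne_zero h
  exact ⟨a, a⁻¹ * g, by simp, left_ne_zero_of_mul ha, right_ne_zero_of_mul ha⟩

lemma mem_of_uniformOn_ne_zero {S : Set G} {g : G} (h : uniformOn S g ≠ 0) : g ∈ S := by
  by_contra hg
  exact h (by simp [uniformOn, hg])

/-- A measure of total mass one carried by `A` is at distance at least `1 - |A| / |G|` from the
uniform measure. -/
lemma one_sub_card_div_le_tvDist [Fintype G] [Nonempty G] {μ : G → ℝ} (hμ : ∑ g, μ g = 1) (A : Finset G)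
    (hA : ∀ g, μ g ≠ 0 → g ∈ A) :
    1 - (#A : ℝ) / Fintype.card G ≤ tvDist μ (uniformOn (Set.univ : Set G)) := by
  classical
  set ν : G → ℝ := uniformOn (Set.univ : Set G) with hν
  have hν_sum : ∑ g, ν g = 1 := sum_uniformOn Set.univ_nonempty
  have hνA : ∑ g ∈ A, ν g = (#A : ℝ) / Fintype.card G := by
    simp [hν, uniformOn, div_eq_mul_inv]
  have hμA : ∑ g ∈ A, μ g = 1 := by
    rw [← hμ]
    refine Finset.sum_subset (Finset.subset_univ A) fun g _ hg => ?_
    by_contra h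
    exact hg (hA g h)
  have hμs := Finset.sum_add_sum_compl A μ
  have hνs := Finset.sum_add_sum_compl A ν
  have h1 : ∑ g ∈ A, (μ g - ν g) ≤ ∑ g ∈ A, |μ g - ν g| :=
    Finset.sum_le_sum fun g _ => le_abs_self _
  have h2 : ∑ g ∈ Aᶜ, (ν g - μ g) ≤ ∑ g ∈ Aᶜ, |μ g - ν g| :=
    Finset.sum_le_sum fun g _ => by rw [abs_sub_comm]; exact le_abs_self _
  rw [Finset.sum_sub_distrib] at h1 h2
  have hs := Finset.sum_add_sum_compl A fun g => |μ g - ν g|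
  simp only [tvDist]
  linarith

end Measures

section FixedVectors

variable {K : Type} [Field K]

lemma exists_linearEquiv_apply_eq {V : Type*} [AddCommGroup V] [Module K V] {v w : V}
    (hv : v ≠ 0) (hw : w ≠ 0) : ∃ e : V ≃ₗ[K] V, e v = w := by
  have : FiniteDimensional K (Submodule.span K {v}) := inferInstance
  obtain ⟨g, hg⟩ := Submodule.exists_linearEquiv_restrict_eq
    ((LinearEquiv.toSpanNonzeroSingleton K V v hv).symm ≪≫ₗ
      LinearEquiv.toSpanNonzeroSingleton K V w hw)
  refine ⟨g, ?_⟩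
  have h := hg (LinearEquiv.toSpanNonzeroSingleton K V v hv 1)
  rw [LinearEquiv.trans_apply, LinearEquiv.symm_apply_apply] at h
  simpa using h.symm

lemma rank_add_le_add_rank {m : ℕ} (A B : Matrix (Fin m) (Fin m) K) :
    (A + B).rank ≤ A.rank + B.rank := by
  rw [Matrix.rank, Matrix.rank, Matrix.rank, Matrix.mulVecLin_add]
  exact (Submodule.finrank_mono (LinearMap.range_add_le _ _)).trans
    (Submodule.finrank_add_le_finrank_add_finrank _ _)

lemma rank_mul_sub_one_le {m : ℕ} (A B : Matrix (Fin m) (Fin m) K) :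
    (A * B - 1).rank ≤ (A - 1).rank + (B - 1).rank := by
  have h : A * B - 1 = (A - 1) * B + (B - 1) := by noncomm_ring
  rw [h]
  exact (rank_add_le_add_rank _ _).trans (Nat.add_le_add_right (Matrix.rank_mul_le_left _ _) _)

variable [Fintype K] [DecidableEq K]

open Finset

lemma card_fixed_vectors {m : ℕ} (A : Matrix (Fin m) (Fin m) K) :
    #{v : Fin m → K | A *ᵥ v = v} = Fintype.card K ^ (m - (A - 1).rank) := by
  classical
  have h := (A - 1).mulVecLin.finrank_range_add_finrank_ker
  rw [← Matrix.rank, Module.finrank_fin_fun] at h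
  have h' : m - (A - 1).rank = Module.finrank K (LinearMap.ker (A - 1).mulVecLin) := by omega
  rw [h', ← Module.card_eq_pow_finrank, ← Fintype.card_subtype]
  refine Fintype.card_congr (Equiv.subtypeEquivRight fun v => ?_)
  simp [sub_eq_zero]

/-- Burnside's lemma for the natural action of `GL_m`, which has at most two orbits. -/
lemma sum_card_fixed_vectors_le (m : ℕ) :
    ∑ g : GL (Fin m) K, #{v : Fin m → K | (g : Matrix (Fin m) (Fin m) K) *ᵥ v = v} ≤
      2 * Fintype.card (GL (Fin m) K) := by
  classical
  let _ : MulAction (GL (Fin m) K) (Fin m → K) :=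
    { smul := fun g v => (g : Matrix (Fin m) (Fin m) K) *ᵥ v
      one_smul := fun v => Matrix.one_mulVec v
      mul_smul := fun g h v => (Matrix.mulVec_mulVec v g.1 h.1).symm }
  have hsmul (g : GL (Fin m) K) (v : Fin m → K) :
      g • v = (g : Matrix (Fin m) (Fin m) K) *ᵥ v := rfl
  have hb := MulAction.sum_card_fixedBy_eq_card_orbits_mul_card_group (GL (Fin m) K) (Fin m → K)
  have horb : Fintype.card (Quotient (MulAction.orbitRel (GL (Fin m) K) (Fin m → K))) ≤ 2 := by
    rw [← Fintype.card_bool]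
    refine Fintype.card_le_of_surjective
      (fun b : Bool => Quotient.mk _ (if b then (0 : Fin m → K) else 1)) ?_
    intro x
    induction x using Quotient.inductionOn with
    | h v =>
      by_cases hv : v = 0
      · exact ⟨true, by simp [hv]⟩
      · have h1 : (1 : Fin m → K) ≠ 0 := by
          obtain ⟨i, -⟩ := Function.ne_iff.mp hv
          exact fun h => one_ne_zero (congrFun h i)
        obtain ⟨e, he⟩ := exists_linearEquiv_apply_eq (K := K) hv h1
        refine ⟨false, Quotient.sound ?_⟩
        refine ⟨Matrix.GeneralLinearGroup.toLin.symm
          (LinearMap.GeneralLinearGroup.ofLinearEquiv (R := K) (M := Fin m → K) e), ?_⟩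
        change _ • v = _
        rw [hsmul, ← Matrix.mulVecLin_apply, ← Matrix.GeneralLinearGroup.coe_toLin]
        simpa using he
  calc _ = ∑ g : GL (Fin m) K, Fintype.card (MulAction.fixedBy (Fin m → K) g) := by
        refine Finset.sum_congr rfl fun g _ => ?_
        rw [← Fintype.card_subtype]
        exact Fintype.card_congr (Equiv.refl _)
    _ ≤ _ := by rw [hb]; exact Nat.mul_le_mul_right _ horb

lemma card_rank_sub_one_le_mul_pow {m r : ℕ} :
    #{g : GL (Fin m) K | ((g : Matrix (Fin m) (Fin m) K) - 1).rank ≤ r} *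
      Fintype.card K ^ (m - r) ≤ 2 * Fintype.card (GL (Fin m) K) := by
  refine le_trans ?_ (sum_card_fixed_vectors_le m)
  rw [← smul_eq_mul]
  refine (Finset.card_nsmul_le_sum _ (fun g : GL (Fin m) K =>
    #{v : Fin m → K | (g : Matrix (Fin m) (Fin m) K) *ᵥ v = v}) _ fun g hg => ?_).trans
    (Finset.sum_le_univ_sum_of_nonneg fun _ => Nat.zero_le _)
  rw [card_fixed_vectors]
  have := (Finset.mem_filter.mp hg).2
  exact Nat.pow_le_pow_right Fintype.card_pos (by omega)

end FixedVectors

section Walk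

lemma exists_transvection_not_inSp (K : Type) [Field K] {n : ℕ} (hn : 2 ≤ n) :
    {g : GL (Fin (2 * n)) K | IsTransvection K g ∧ ¬ InSp K g}.Nonempty := by
  let i : Fin (2 * n) := ⟨0, by omega⟩
  let j : Fin (2 * n) := ⟨1, by omega⟩
  let l : Fin (2 * n) := ⟨n, by omega⟩
  have hij : i ≠ j := by simp [i, j]
  have hjl : j ≠ l := by simp [j, l]; omega
  let E : Matrix (Fin (2 * n)) (Fin (2 * n)) K := Matrix.single i j 1
  have hE0 : E ≠ 0 := by
    intro h
    have := congrFun (congrFun h i) j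
    simp [E] at this
  have hEE : E * E = 0 := by simp [E, hij.symm]
  let g : GL (Fin (2 * n)) K :=
    ⟨1 + E, 1 - E, by simp [mul_sub, add_mul, hEE], by simp [mul_add, sub_mul, hEE]⟩
  have hg : (g : Matrix (Fin (2 * n)) (Fin (2 * n)) K) = 1 + E := rfl
  refine ⟨g, ⟨?_, ?_, ?_⟩, ?_⟩
  · intro h
    apply hE0
    have := congrArg Units.val h
    simpa [hg] using this
  · rw [hg, add_sub_cancel_left]
    refine le_antisymm ?_ ?_
    · have : E = Matrix.vecMulVec (Pi.single i 1) (Pi.single j 1) := by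
        simp [E, Matrix.single_eq_single_vecMulVec_single]
      rw [this]
      exact Matrix.rank_vecMulVec_le _ _
    · rw [Nat.one_le_iff_ne_zero]
      intro h
      rw [Matrix.rank, Submodule.finrank_eq_zero, LinearMap.range_eq_bot] at h
      exact hE0 (Matrix.toLin'.injective (by rw [map_zero]; exact h))
  · rw [hg, add_sub_cancel_left, pow_two, hEE]
  · intro h
    have h' := congrFun (congrFun h j) l
    rw [hg] at h'
    simp [E, Matrix.transpose_add, add_mul, mul_add, hjl, hjl.symm, Jmat, i, j, l] at h'

variable {F}

lemma rank_sub_one_le_of_convPow_ne_zero {n k : ℕ} {g : GL (Fin (2 * n)) F}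
    (h : convPow (Pmeas F n) k g ≠ 0) :
    ((g : Matrix (Fin (2 * n)) (Fin (2 * n)) F) - 1).rank ≤ k := by
  induction k generalizing g with
  | zero =>
    have hg : g = 1 := by
      by_contra hg
      exact h (by simp [convPow, hg])
    simp [hg]
  | succ k ih =>
    obtain ⟨a, b, rfl, ha, hb⟩ := exists_mul_eq_of_conv_ne_zero h
    have hb' := (mem_of_uniformOn_ne_zero hb).1.2.1
    exact (rank_mul_sub_one_le _ _).trans (Nat.add_le_add (ih ha) hb'.le)

lemma rank_sub_one_le_of_Dmeas_ne_zero {K : Type} [Field K] [DecidableEq K] {n : ℕ} {g : GL (Fin (2 * n)) K}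
    (h : Dmeas K n g ≠ 0) :
    ((g : Matrix (Fin (2 * n)) (Fin (2 * n)) K) - 1).rank ≤ 1 := by
  obtain ⟨α, hα⟩ := mem_of_uniformOn_ne_zero h
  rw [hα, ← Matrix.diagonal_one, Matrix.diagonal_sub, Matrix.rank_diagonal]
  rw [Fintype.card_le_one_iff]
  rintro ⟨a, ha⟩ ⟨b, hb⟩
  have key : ∀ a : Fin (2 * n), (if (a : ℕ) = 0 then (α : K) else 1) - 1 ≠ 0 → (a : ℕ) = 0 := by
    intro a ha
    by_contra h
    simp [h] at ha
  ext
  rw [key a ha, key b hb]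

lemma sum_Dmeas (n : ℕ) : ∑ g, Dmeas F n g = 1 :=
  sum_uniformOn ⟨1, 1, by simp⟩

end Walk

/-- **Lower bound** (Theorem 1.2): there exist `A, B > 0` and `N` such that for all `n ≥ N`
(and `n ≥ 1`) and all `0 ≤ c ≤ n`, `‖P_n^{*(n−c)} * D_n − U_n‖ ≥ 1 − A e^{−Bc}`. -/
theorem lower_bound :
    ∃ A B : ℝ, 0 < A ∧ 0 < B ∧ ∃ N : ℕ, ∀ n : ℕ, N ≤ n → 1 ≤ n → ∀ c : ℕ, c ≤ n →
      1 - A * Real.exp (-B * c) ≤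
        tvDist (conv (convPow (Pmeas F n) (n - c)) (Dmeas F n)) (Umeas F n) := by
  refine ⟨2, Real.log 2, two_pos, Real.log_pos one_lt_two, 2, fun n hn _ c hc => ?_⟩
  have hμ : ∑ g, conv (convPow (Pmeas F n) (n - c)) (Dmeas F n) g = 1 := by
    rw [sum_conv, sum_Dmeas, sum_convPow (μ := Pmeas F n) (sum_uniformOn (exists_transvection_not_inSp F hn)),
      one_mul]
  refine le_trans ?_ (one_sub_card_div_le_tvDist hμ
    {g | ((g : Matrix (Fin (2 * n)) (Fin (2 * n)) F) - 1).rank ≤ n - c + 1} fun g hg => ?_)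
  · have hcard := card_rank_sub_one_le_mul_pow (K := F) (m := 2 * n) (r := n - c + 1)
    set a := Finset.card
      {g : GL (Fin (2 * n)) F | ((g : Matrix (Fin (2 * n)) (Fin (2 * n)) F) - 1).rank ≤ n - c + 1}
    have hpow : 2 ^ c ≤ Fintype.card F ^ (2 * n - (n - c + 1)) :=
      (Nat.pow_le_pow_left Fintype.one_lt_card c).trans
        (Nat.pow_le_pow_right Fintype.card_pos (by omega))
    have hle : (a : ℝ) * 2 ^ c ≤ 2 * Fintype.card (GL (Fin (2 * n)) F) := by
      exact_mod_cast (Nat.mul_le_mul_left a hpow).trans hcard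
    have hexp : Real.exp (-Real.log 2 * c) = (2 ^ c)⁻¹ := by
      rw [neg_mul, Real.exp_neg, mul_comm, Real.exp_nat_mul, Real.exp_log two_pos]
    have hG : (0 : ℝ) < Fintype.card (GL (Fin (2 * n)) F) := by exact_mod_cast Fintype.card_pos
    rw [hexp, sub_le_sub_iff_left, ← div_eq_mul_inv, div_le_div_iff₀ hG (by positivity)]
    exact hle
  · obtain ⟨x, y, rfl, hx, hy⟩ := exists_mul_eq_of_conv_ne_zero hg
    exact Finset.mem_filter.mpr ⟨Finset.mem_univ _, (rank_mul_sub_one_le _ _).trans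
      (Nat.add_le_add (rank_sub_one_le_of_convPow_ne_zero hx)
        (rank_sub_one_le_of_Dmeas_ne_zero hy))⟩
end
end

section
/- Let q be a prime power and n ≥ 2. If t and t' are two transvections in GL_{2n}(F_q) neither of which lies in Sp_{2n}(F_q), then there exist k₁, k₂ ∈ Sp_{2n}(F_q) with t' = k₁ t k₂. In other words, the non-symplectic transvections form a single Sp_{2n}(F_q)-double coset in GL_{2n}(F_q). -/
open Matrix

noncomputable section

variable (F : Type) [Field F] [Fintype F] [DecidableEq F]

section AlternatingForm

variable {K V : Type*} [Field K] [AddCommGroup V] [Module K V] {B : LinearMap.BilinForm K V}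

theorem exists_orthogonal_apply_ne_zero (hB : B.SeparatingLeft) {v w : V}
    (hw : w ∉ K ∙ v) : ∃ z, B v z = 0 ∧ B w z ≠ 0 := by
  by_contra! h
  have hspan : B w ∈ Submodule.span K (Set.range fun _ : Unit => B v) :=
    mem_span_of_iInf_ker_le_ker (by
      intro z hz
      simp only [iInf_const, LinearMap.mem_ker] at hz ⊢
      exact h z hz)
  rw [Set.range_const, Submodule.mem_span_singleton] at hspan
  obtain ⟨c, hc⟩ := hspan
  refine hw (Submodule.mem_span_singleton.2 ⟨c, ?_⟩)
  rw [← sub_eq_zero]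
  refine hB _ fun y => ?_
  have := LinearMap.congr_fun hc y
  simp only [LinearMap.smul_apply, smul_eq_mul] at this
  simp [this]

/-- A symplectic transvection along `w' - w` moves `w` to `w'`. -/
theorem exists_isometry_of_apply_ne_zero (hB : B.IsAlt) {v w w' : V}
    (hvw : B v w = 0) (hvw' : B v w' = 0) (hww' : B w w' ≠ 0) :
    ∃ e : V ≃ₗ[K] V, (∀ x y, B (e x) (e y) = B x y) ∧ e v = v ∧ e w = w' := by
  have hskew := hB.neg_eq
  let φ : Module.Dual K V := (-(B w w')⁻¹) • B (w' - w)
  have hφ : φ (w' - w) = 0 := by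
    rw [LinearMap.smul_apply, hB.self_eq_zero, smul_zero]
  refine ⟨LinearEquiv.transvection hφ, fun x y => ?_, ?_, ?_⟩
  · simp only [LinearEquiv.transvection.apply, φ, LinearMap.smul_apply, map_add, map_smul,
      LinearMap.add_apply, smul_eq_mul, hB.self_eq_zero]
    rw [← hskew x (w' - w)]
    ring
  · have h : B (w' - w) v = 0 := by rw [← hskew]; simp [hvw, hvw']
    rw [LinearEquiv.transvection.apply, LinearMap.smul_apply, h, smul_zero, zero_smul, add_zero]
  · have h : B (w' - w) w = - B w w' := by rw [hskew w w']; simp [hB.self_eq_zero]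
    rw [LinearEquiv.transvection.apply, LinearMap.smul_apply, h]
    simp only [smul_eq_mul, neg_mul_neg, inv_mul_cancel₀ hww', one_smul, add_sub_cancel]

/-- The stabilizer of `v` in the isometry group of an alternating form acts transitively on the
vectors orthogonal to `v` and not proportional to it. -/
theorem exists_isometry_fixing (hB : B.IsAlt) (hB' : B.SeparatingLeft) {v w w' : V}
    (hvw : B v w = 0) (hvw' : B v w' = 0) (hw : w ∉ K ∙ v) (hw' : w' ∉ K ∙ v) :
    ∃ e : V ≃ₗ[K] V, (∀ x y, B (e x) (e y) = B x y) ∧ e v = v ∧ e w = w' := by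
  obtain ⟨z, hvz, hwz, hw'z⟩ : ∃ z, B v z = 0 ∧ B w z ≠ 0 ∧ B w' z ≠ 0 := by
    obtain ⟨a, hva, hwa⟩ := exists_orthogonal_apply_ne_zero hB' hw
    obtain ⟨b, hvb, hwb⟩ := exists_orthogonal_apply_ne_zero hB' hw'
    by_cases ha : B w' a = 0
    · by_cases hb : B w b = 0
      · exact ⟨a + b, by simp [hva, hvb], by simp [hwa, hb], by simp [ha, hwb]⟩
      · exact ⟨b, hvb, hb, hwb⟩
    · exact ⟨a, hva, hwa, ha⟩
  obtain ⟨e₁, he₁, he₁v, he₁w⟩ := exists_isometry_of_apply_ne_zero hB hvw hvz hwz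
  have hzw' : B z w' ≠ 0 := by rw [← hB.neg_eq]; simpa using hw'z
  obtain ⟨e₂, he₂, he₂v, he₂z⟩ := exists_isometry_of_apply_ne_zero hB hvz hvw' hzw'
  exact ⟨e₁.trans e₂, fun x y => by simp [he₁, he₂], by simp [he₁v, he₂v], by simp [he₁w, he₂z]⟩

/-- Witt's theorem for pairs of independent orthogonal vectors of an alternating form. -/
theorem exists_isometry_pair (hB : B.IsAlt) (hB' : B.SeparatingLeft) {v w v' w' : V}
    (hv : v ≠ 0) (hv' : v' ≠ 0) (hw : w ∉ K ∙ v) (hw' : w' ∉ K ∙ v')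
    (hvw : B v w = 0) (hvw' : B v' w' = 0) :
    ∃ e : V ≃ₗ[K] V, (∀ x y, B (e x) (e y) = B x y) ∧ e v = v' ∧ e w = w' := by
  obtain ⟨e₁, he₁, -, he₁v⟩ := exists_isometry_fixing (v := 0) (w := v) (w' := v') hB hB'
    (by simp) (by simp) (by simpa using hv) (by simpa using hv')
  have hw₁ : e₁ w ∉ K ∙ v' := by
    intro h
    obtain ⟨c, hc⟩ := Submodule.mem_span_singleton.1 h
    refine hw (Submodule.mem_span_singleton.2 ⟨c, e₁.injective ?_⟩)
    rw [map_smul, he₁v, hc]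
  obtain ⟨e₂, he₂, he₂v, he₂w⟩ := exists_isometry_fixing hB hB'
    (by rw [← he₁v, he₁, hvw]) hvw' hw₁ hw'
  exact ⟨e₁.trans e₂, fun x y => by simp [he₁, he₂], by simp [he₁v, he₂v], by simp [he₂w]⟩

end AlternatingForm

theorem exists_eq_vecMulVec_of_rank_eq_one {K m n : Type*} [Field K] [Fintype n] [DecidableEq n]
    [Finite m] {N : Matrix m n K} (hN : N.rank = 1) : ∃ v f, N = vecMulVec v f := by
  obtain ⟨v, -, hv⟩ := finrank_eq_one_iff'.1 hN
  choose c hc using fun j => hv ⟨N *ᵥ Pi.single j 1, Pi.single j 1, rfl⟩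
  refine ⟨v, c, ?_⟩
  ext i j
  have := congrFun (congrArg Subtype.val (hc j)) i
  simp only [SetLike.val_smul, Pi.smul_apply, smul_eq_mul, mulVec_single_one, col_apply] at this
  rw [vecMulVec_apply, mul_comm, this]

section StandardForm

variable {K : Type} [Field K] {n : ℕ}

theorem Jmat_transpose_mul_self : (Jmat K n)ᵀ * Jmat K n = 1 := by
  ext i j
  rw [mul_apply]
  simp only [transpose_apply, Jmat, of_apply, one_apply]
  by_cases hi : (i : ℕ) < n
  · rw [Finset.sum_eq_single (⟨i + n, by omega⟩ : Fin (2 * n))]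
    · split_ifs <;> grind
    · intro k _ hk
      have : (k : ℕ) ≠ i + n := fun h => hk (Fin.ext h)
      split_ifs <;> grind
    · simp
  · rw [Finset.sum_eq_single (⟨i - n, by omega⟩ : Fin (2 * n))]
    · split_ifs <;> grind
    · intro k _ hk
      have : (k : ℕ) ≠ i - n := fun h => hk (Fin.ext h)
      split_ifs <;> grind
    · simp

variable (K n) in
/-- The standard symplectic form `ω(x, y) = xᵀ J y`. -/
abbrev symplecticForm : LinearMap.BilinForm K (Fin (2 * n) → K) :=
  toLinearMap₂' K (Jmat K n)

theorem symplecticForm_isAlt : (symplecticForm K n).IsAlt := by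
  intro x
  rw [toLinearMap₂'_apply, ← Finset.sum_product']
  refine Finset.sum_involution (fun p _ => p.swap) ?_ ?_ ?_ ?_
  · rintro ⟨i, j⟩ -
    simp only [Prod.swap, Jmat, of_apply, smul_eq_mul]
    split_ifs <;> first | omega | ring
  · rintro ⟨i, j⟩ - h heq
    obtain rfl : j = i := congrArg Prod.fst heq
    refine h ?_
    simp only [Jmat, of_apply, smul_eq_mul]
    split_ifs <;> first | omega | simp
  · simp
  · simp

theorem symplecticForm_separatingLeft : (symplecticForm K n).SeparatingLeft := by
  refine LinearMap.separatingLeft_toLinearMap₂'_of_det_ne_zero' fun h => ?_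
  have := congrArg det (Jmat_transpose_mul_self (K := K) (n := n))
  simp [h] at this

theorem inSp_iff {g : GL (Fin (2 * n)) K} : InSp K g ↔
    ∀ x y, symplecticForm K n (g.1 *ᵥ x) (g.1 *ᵥ y) = symplecticForm K n x y := by
  have h : ∀ x y, symplecticForm K n (g.1 *ᵥ x) (g.1 *ᵥ y) =
      toLinearMap₂' K (g.1ᵀ * Jmat K n * g.1) x y := fun x y => by
    simp only [toLinearMap₂'_apply', ← mulVec_mulVec, dotProduct_mulVec, vecMul_transpose]
  simp only [h, InSp]
  exact (toLinearMap₂' K).injective.eq_iff.symm.trans LinearMap.ext_iff₂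

/-- A non-symplectic transvection is `x ↦ x + ω(w, x) v` with `v`, `w` independent and
orthogonal. -/
theorem IsTransvection.exists_independent {g : GL (Fin (2 * n)) K} (hg : IsTransvection K g)
    (hgs : ¬ InSp K g) : ∃ v w, v ≠ 0 ∧ w ∉ K ∙ v ∧ symplecticForm K n v w = 0 ∧
      ∀ x, g.1 *ᵥ x = x + symplecticForm K n w x • v := by
  obtain ⟨hg1, hrank, hsq⟩ := hg
  obtain ⟨v, f, hvf⟩ := exists_eq_vecMulVec_of_rank_eq_one hrank
  have hne : vecMulVec v f ≠ 0 := by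
    rw [← hvf, sub_ne_zero]
    exact fun h => hg1 (Units.ext h)
  have hfv : f ⬝ᵥ v = 0 := by
    rw [hvf, pow_two, vecMulVec_mul_vecMulVec] at hsq
    simpa [hne] using hsq
  have hf : ∀ x, symplecticForm K n (f ᵥ* (Jmat K n)ᵀ) x = f ⬝ᵥ x := fun x => by
    rw [toLinearMap₂'_apply', dotProduct_mulVec, vecMul_vecMul, Jmat_transpose_mul_self,
      vecMul_one]
  have hgx : ∀ x, g.1 *ᵥ x =
      x + symplecticForm K n (f ᵥ* (Jmat K n)ᵀ) x • v := fun x => by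
    rw [hf, ← sub_eq_iff_eq_add']
    have := congrArg (· *ᵥ x) hvf
    simpa [sub_mulVec, vecMulVec_mulVec] using this
  refine ⟨v, f ᵥ* (Jmat K n)ᵀ, ?_, ?_, ?_, hgx⟩
  · rintro rfl
    simp at hne
  · intro hmem
    obtain ⟨c, hc⟩ := Submodule.mem_span_singleton.1 hmem
    refine hgs (inSp_iff.2 fun x y => ?_)
    rw [hgx, hgx, ← hc]
    simp only [map_add, map_smul, LinearMap.add_apply, LinearMap.smul_apply, smul_eq_mul,
      symplecticForm_isAlt.self_eq_zero]
    rw [← symplecticForm_isAlt.neg_eq x v]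
    ring
  · rw [← symplecticForm_isAlt.neg_eq, hf, hfv, neg_zero]

end StandardForm

/-- The non-symplectic transvections form a single `Sp_{2n}(F_q)`-double coset:
any two transvections `t, t'` in `GL_{2n}(F_q)` not lying in `Sp_{2n}(F_q)` satisfy
`t' = k₁ t k₂` for some `k₁, k₂ ∈ Sp_{2n}(F_q)`. -/
theorem nonsymplectic_transvections_single_double_coset
    (n : ℕ) (hn : 2 ≤ n) (t t' : GL (Fin (2 * n)) F)
    (ht : IsTransvection F t) (ht' : IsTransvection F t')
    (hts : ¬ InSp F t) (hts' : ¬ InSp F t') :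
    ∃ k₁ k₂ : GL (Fin (2 * n)) F, InSp F k₁ ∧ InSp F k₂ ∧ t' = k₁ * t * k₂ := by
  obtain ⟨v, w, hv, hw, hvw, htx⟩ := ht.exists_independent hts
  obtain ⟨v', w', hv', hw', hvw', htx'⟩ := ht'.exists_independent hts'
  obtain ⟨e, he, hev, hew⟩ :=
    exists_isometry_pair symplecticForm_isAlt symplecticForm_separatingLeft hv hv' hw hw' hvw hvw'
  let k : GL (Fin (2 * n)) F := GeneralLinearGroup.toLin.symm
    (LinearMap.GeneralLinearGroup.ofLinearEquiv e)
  have hk : ∀ x, k.1 *ᵥ x = e x := fun x => by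
    change LinearMap.toMatrix' (e : _ →ₗ[F] _) *ᵥ x = e x
    simp [LinearMap.toMatrix'_mulVec]
  have hkSp : InSp F k := inSp_iff.2 fun x y => by rw [hk, hk, he]
  have hkinv : InSp F k⁻¹ := inSp_iff.2 fun x y => by
    rw [← inSp_iff.1 hkSp]
    simp [mulVec_mulVec]
  refine ⟨k, k⁻¹, hkSp, hkinv, ?_⟩
  rw [eq_mul_inv_iff_mul_eq]
  refine Units.ext (ext_of_mulVec_single fun i => ?_)
  simp only [Units.val_mul, ← mulVec_mulVec]
  rw [htx', htx, hk, hk, map_add, map_smul, hev, ← hew, he]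
end
end

section
/- There exists a constant C > 0 such that for every prime power q, every n ≥ 1 and every integer c ≥ 0, the set A_c = {g ∈ GL_{2n}(F_q) : g = k·g₀ for some k ∈ Sp_{2n}(F_q) and some g₀ ∈ GL_{2n}(F_q) with dim ker(g₀ − I) ≥ n + c} satisfies |A_c| ≤ (C/q^c)·|GL_{2n}(F_q)|. -/
open Matrix

noncomputable section

variable (F : Type) [Field F] [Fintype F] [DecidableEq F]

section GeneralLinear

variable {K : Type} [Field K]

theorem Jmat_eq_sub_transpose {n : ℕ} (hn : 1 ≤ n) :
    Jmat K n = (Matrix.of fun i j : Fin (2 * n) => if (j : ℕ) = i + n then (1 : K) else 0) -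
      (Matrix.of fun i j : Fin (2 * n) => if (j : ℕ) = i + n then (1 : K) else 0)ᵀ := by
  ext i j
  simp only [Jmat, of_apply, Matrix.sub_apply, transpose_apply]
  split_ifs <;> first | omega | simp

theorem Jmat_mulVec_dotProduct_self {n : ℕ} (hn : 1 ≤ n) (v : Fin (2 * n) → K) :
    (Jmat K n *ᵥ v) ⬝ᵥ v = 0 := by
  rw [Jmat_eq_sub_transpose hn, sub_mulVec, sub_dotProduct, mulVec_transpose,
    ← dotProduct_mulVec, dotProduct_comm, sub_self]

theorem Jmat_mulVec_ne_zero {n : ℕ} {v : Fin (2 * n) → K} (hv : v ≠ 0) :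
    Jmat K n *ᵥ v ≠ 0 := by
  contrapose! hv
  ext j
  obtain ⟨j, hj⟩ := j
  rcases lt_or_ge j n with h | h
  · have := congrFun hv ⟨j + n, by omega⟩
    simp only [mulVec, dotProduct, Jmat, of_apply, Pi.zero_apply] at this
    rw [Finset.sum_eq_single ⟨j, hj⟩] at this
    · simpa [show j ≠ j + n + n by omega] using this
    · rintro ⟨b, hb⟩ - hne
      rw [if_neg (by simp; omega), if_neg (by simp at hne ⊢; omega), zero_mul]
    · simp
  · have := congrFun hv ⟨j - n, by omega⟩
    simp only [mulVec, dotProduct, Jmat, of_apply, Pi.zero_apply] at this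
    rw [Finset.sum_eq_single ⟨j, hj⟩] at this
    · simpa [h] using this
    · rintro ⟨b, hb⟩ - hne
      rw [if_neg (by simp at hne ⊢; omega), if_neg (by simp; omega), zero_mul]
    · simp

theorem exists_dotProduct_eq_one {m : Type*} [Fintype m] [DecidableEq m] {v : m → K}
    (hv : v ≠ 0) : ∃ a : m → K, v ⬝ᵥ a = 1 := by
  obtain ⟨i, hi⟩ := Function.ne_iff.mp hv
  exact ⟨Pi.single i (v i)⁻¹, by rw [dotProduct_single]; exact mul_inv_cancel₀ hi⟩

/-- The rank-one perturbation `1 + a χᵀ` of the identity, as an element of `GL`. -/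
def rankOneGL {m : Type*} [Fintype m] [DecidableEq m] (a χ : m → K) (h : χ ⬝ᵥ a ≠ -1) :
    GL m K :=
  GeneralLinearGroup.mkOfDetNeZero (1 + vecMulVec a χ) (by
    rw [vecMulVec_eq Unit, det_one_add_replicateCol_mul_replicateRow]
    contrapose! h
    exact (neg_eq_of_add_eq_zero_right h).symm)

theorem transpose_rankOneGL_mulVec {m : Type*} [Fintype m] [DecidableEq m] {a χ φ : m → K}
    (h : χ ⬝ᵥ a ≠ -1) (ha : φ ⬝ᵥ a = 1) :
    (rankOneGL a χ h : Matrix m m K)ᵀ *ᵥ φ = φ + χ := by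
  simp [rankOneGL, GeneralLinearGroup.mkOfDetNeZero, add_mulVec, transpose_vecMulVec,
    vecMulVec_mulVec, dotProduct_comm a, ha]

theorem rankOneGL_mulVec {m : Type*} [Fintype m] [DecidableEq m] {a χ v : m → K}
    (h : χ ⬝ᵥ a ≠ -1) (hv : χ ⬝ᵥ v = 0) :
    (rankOneGL a χ h : Matrix m m K) *ᵥ v = v := by
  simp [rankOneGL, GeneralLinearGroup.mkOfDetNeZero, add_mulVec, vecMulVec_mulVec, hv]

/-- A matrix whose bilinear form vanishes on a subspace `W` has kernel of dimension at least
`2 dim W - |m|`. -/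
theorem two_mul_finrank_le_finrank_ker_add {m : Type*} [Fintype m] [DecidableEq m]
    (B : Matrix m m K) (W : Submodule K (m → K))
    (hW : ∀ x ∈ W, ∀ y ∈ W, (B *ᵥ x) ⬝ᵥ y = 0) :
    2 * Module.finrank K W ≤ Module.finrank K (LinearMap.ker B.toLin') + Fintype.card m := by
  let L : W →ₗ[K] Module.Dual K (m → K) :=
    ((dotProductEquiv K m).toLinearMap ∘ₗ B.toLin').domRestrict W
  have hrange : LinearMap.range L ≤ W.dualAnnihilator := by
    rintro _ ⟨⟨x, hx⟩, rfl⟩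
    rw [Submodule.mem_dualAnnihilator]
    intro y hy
    simpa [L] using hW x hx y hy
  have h₁ := Submodule.finrank_mono hrange
  have h₂ := Subspace.finrank_add_finrank_dualAnnihilator_eq W
  have h₃ := L.finrank_range_add_finrank_ker
  have hker : (LinearMap.ker L).map W.subtype ≤ LinearMap.ker B.toLin' := by
    rintro _ ⟨⟨x, hx⟩, h, rfl⟩
    simpa [L] using h
  have h₄ := Submodule.finrank_mono hker
  rw [Submodule.finrank_map_subtype_eq] at h₄
  rw [Module.finrank_fintype_fun_eq_card] at h₂
  omega

theorem two_mul_le_finrank_ker_of_InSp {n c : ℕ} {k g₀ : GL (Fin (2 * n)) K} (hk : InSp K k)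
    (h : n + c ≤ Module.finrank K (LinearMap.ker
      (Matrix.toLin' ((g₀ : Matrix (Fin (2 * n)) (Fin (2 * n)) K) - 1)))) :
    2 * c ≤ Module.finrank K (LinearMap.ker (Matrix.toLin'
      (((k * g₀ : GL (Fin (2 * n)) K) : Matrix (Fin (2 * n)) (Fin (2 * n)) K)ᵀ * Jmat K n *
        ((k * g₀ : GL (Fin (2 * n)) K) : Matrix (Fin (2 * n)) (Fin (2 * n)) K) - Jmat K n))) := by
  have := two_mul_finrank_le_finrank_ker_add (B := ((k * g₀ : GL (Fin (2 * n)) K) :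
    Matrix (Fin (2 * n)) (Fin (2 * n)) K)ᵀ * Jmat K n * ((k * g₀ : GL (Fin (2 * n)) K) :
      Matrix (Fin (2 * n)) (Fin (2 * n)) K) - Jmat K n) (W := LinearMap.ker
      (Matrix.toLin' ((g₀ : Matrix (Fin (2 * n)) (Fin (2 * n)) K) - 1))) ?_
  · rw [Fintype.card_fin] at this
    omega
  · intro x hx y hy
    simp only [LinearMap.mem_ker, toLin'_apply, sub_mulVec, one_mulVec, sub_eq_zero] at hx hy
    have hgx : ((k * g₀ : GL (Fin (2 * n)) K) : Matrix (Fin (2 * n)) (Fin (2 * n)) K)ᵀ *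
        Jmat K n * ((k * g₀ : GL (Fin (2 * n)) K) : Matrix (Fin (2 * n)) (Fin (2 * n)) K) =
        (g₀ : Matrix (Fin (2 * n)) (Fin (2 * n)) K)ᵀ * Jmat K n * g₀ := by
      conv_rhs => rw [← hk]
      simp only [Units.val_mul, transpose_mul, Matrix.mul_assoc]
    rw [hgx, sub_mulVec, sub_dotProduct, ← mulVec_mulVec, ← mulVec_mulVec, hx, mulVec_transpose,
      ← dotProduct_mulVec, hy, sub_self]

variable [Fintype K]

/-- For a fixed `v`, the condition `gᵀ B g v = B v` cuts out a proportion at most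
`2 q / q ^ |m|` of `GL`. -/
theorem card_mulVec_eq_mul_le {m : Type} [Fintype m] [DecidableEq m] (B : Matrix m m K)
    {v : m → K} (hB : B *ᵥ v ≠ 0) (halt : (B *ᵥ v) ⬝ᵥ v = 0) :
    Nat.card {g : GL m K // ((g : Matrix m m K)ᵀ * B * (g : Matrix m m K)) *ᵥ v = B *ᵥ v} *
      Fintype.card K ^ Fintype.card m ≤ 2 * Fintype.card K * Nat.card (GL m K) := by
  classical
  have hv : v ≠ 0 := by rintro rfl; simp at hB
  obtain ⟨a, ha⟩ := exists_dotProduct_eq_one hB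
  obtain ⟨b, hb⟩ := exists_dotProduct_eq_one hv
  rw [dotProduct_comm] at hb
  set φ := B *ᵥ v with hφ
  let χ' : (m → K) → m → K := fun χ => χ - (χ ⬝ᵥ v) • b
  have hχ' (χ) : χ' χ ⬝ᵥ v = 0 := by simp [χ', sub_dotProduct, hb]
  have hshift (χ) (h : χ' χ ⬝ᵥ a = -1) : (χ' χ + φ) ⬝ᵥ a ≠ -1 := by
    simp [add_dotProduct, h, ha]
  have key (g : GL m K) (hg : ((g : Matrix m m K)ᵀ * B * (g : Matrix m m K)) *ᵥ v = φ)
      (χ : m → K) (h : χ ⬝ᵥ a ≠ -1) (hχ : χ ⬝ᵥ v = 0) :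
      (((g * rankOneGL a χ h : GL m K) : Matrix m m K)ᵀ * B *
        ((g * rankOneGL a χ h : GL m K) : Matrix m m K)) *ᵥ v = φ + χ := by
    rw [← transpose_rankOneGL_mulVec h ha, ← hg]
    simp only [Units.val_mul, transpose_mul, ← mulVec_mulVec, rankOneGL_mulVec h hχ]
  have hrec {g₁ g₂ : GL m K} {χ₁ χ₂ : m → K}
      (hg₁ : ((g₁ : Matrix m m K)ᵀ * B * (g₁ : Matrix m m K)) *ᵥ v = φ)
      (hg₂ : ((g₂ : Matrix m m K)ᵀ * B * (g₂ : Matrix m m K)) *ᵥ v = φ)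
      (h₁ : χ₁ ⬝ᵥ a ≠ -1) (h₂ : χ₂ ⬝ᵥ a ≠ -1) (hχ₁ : χ₁ ⬝ᵥ v = 0) (hχ₂ : χ₂ ⬝ᵥ v = 0)
      (he : g₁ * rankOneGL a χ₁ h₁ = g₂ * rankOneGL a χ₂ h₂) : g₁ = g₂ ∧ χ₁ = χ₂ := by
    have h := key g₁ hg₁ χ₁ h₁ hχ₁
    rw [he, key g₂ hg₂ χ₂ h₂ hχ₂, add_right_inj] at h
    subst h
    exact ⟨mul_right_cancel he, rfl⟩
  have hφv (χ) : (χ' χ + φ) ⬝ᵥ v = 0 := by rw [add_dotProduct, hχ', halt, add_zero]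
  let f : {g : GL m K // ((g : Matrix m m K)ᵀ * B * (g : Matrix m m K)) *ᵥ v = φ} ×
      (m → K) → (Bool × K) × GL m K := fun p =>
    if h : χ' p.2 ⬝ᵥ a = -1 then ((true, p.2 ⬝ᵥ v), p.1.1 * rankOneGL a _ (hshift p.2 h))
    else ((false, p.2 ⬝ᵥ v), p.1.1 * rankOneGL a _ h)
  have hf : Function.Injective f := by
    rintro ⟨⟨g₁, hg₁⟩, χ₁⟩ ⟨⟨g₂, hg₂⟩, χ₂⟩ he
    suffices g₁ = g₂ ∧ χ' χ₁ = χ' χ₂ ∧ χ₁ ⬝ᵥ v = χ₂ ⬝ᵥ v by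
      obtain ⟨rfl, h, h'⟩ := this
      have : χ₁ = χ₂ := by simpa [χ', h'] using h
      rw [this]
    simp only [f] at he
    split_ifs at he with h₁ h₂ h₂
    · simp only [Prod.mk.injEq, true_and] at he
      have := hrec hg₁ hg₂ _ _ (hφv _) (hφv _) he.2
      exact ⟨this.1, add_right_cancel this.2, he.1⟩
    · simp at he
    · simp at he
    · simp only [Prod.mk.injEq, true_and] at he
      have := hrec hg₁ hg₂ _ _ (hχ' _) (hχ' _) he.2
      exact ⟨this.1, this.2, he.1⟩
  simpa [Nat.card_prod, Nat.card_eq_fintype_card] using Nat.card_le_card_of_injective f hf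

theorem card_mul_pow_sub_one_le {n c : ℕ} (hn : 1 ≤ n) :
    Nat.card {g : GL (Fin (2 * n)) K | ∃ k g₀ : GL (Fin (2 * n)) K, InSp K k ∧
        n + c ≤ Module.finrank K (LinearMap.ker
          (Matrix.toLin' ((g₀ : Matrix (Fin (2 * n)) (Fin (2 * n)) K) - 1))) ∧
        g = k * g₀} * (Fintype.card K ^ (2 * c) - 1) ≤
      2 * Fintype.card K * Nat.card (GL (Fin (2 * n)) K) := by
  classical
  let r (g : GL (Fin (2 * n)) K) (v : Fin (2 * n) → K) : Prop :=
    ((g : Matrix (Fin (2 * n)) (Fin (2 * n)) K)ᵀ * Jmat K n *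
      (g : Matrix (Fin (2 * n)) (Fin (2 * n)) K)) *ᵥ v = Jmat K n *ᵥ v
  set A := {g : GL (Fin (2 * n)) K | ∃ k g₀ : GL (Fin (2 * n)) K, InSp K k ∧
        n + c ≤ Module.finrank K (LinearMap.ker
          (Matrix.toLin' ((g₀ : Matrix (Fin (2 * n)) (Fin (2 * n)) K) - 1))) ∧
        g = k * g₀}
  have hrow : ∀ g ∈ A.toFinset, Fintype.card K ^ (2 * c) - 1 ≤
      (Finset.bipartiteAbove r (Finset.univ.erase 0) g).card := by
    intro g hg
    obtain ⟨k, g₀, hk, h, rfl⟩ := Set.mem_toFinset.mp hg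
    have hle := Nat.pow_le_pow_right (Fintype.card_pos (α := K))
      (two_mul_le_finrank_ker_of_InSp hk h)
    rw [← Module.card_eq_pow_finrank, Fintype.card_subtype] at hle
    rw [Finset.bipartiteAbove, Finset.filter_erase, Finset.card_erase_of_mem (by simp [r])]
    refine Nat.sub_le_sub_right (hle.trans (Finset.card_le_card fun v hv => ?_)) 1
    simpa only [r, Finset.mem_filter_univ, LinearMap.mem_ker, toLin'_apply, sub_mulVec,
      sub_eq_zero] using hv
  have hcol : ∀ v ∈ Finset.univ.erase (0 : Fin (2 * n) → K),
      (Finset.bipartiteBelow r A.toFinset v).card * Fintype.card K ^ (2 * n) ≤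
        2 * Fintype.card K * Nat.card (GL (Fin (2 * n)) K) := by
    intro v hv
    have h := card_mulVec_eq_mul_le (Jmat K n) (Jmat_mulVec_ne_zero (Finset.ne_of_mem_erase hv))
      (Jmat_mulVec_dotProduct_self hn v)
    rw [Fintype.card_fin, Nat.card_eq_fintype_card, Fintype.card_subtype] at h
    refine (Nat.mul_le_mul_right _ (Finset.card_le_card fun g hg => ?_)).trans h
    simpa [r] using (Finset.mem_bipartiteBelow (r := r)).mp hg |>.2
  have hpos : 0 < Fintype.card K ^ (2 * n) := pow_pos Fintype.card_pos _
  refine Nat.le_of_mul_le_mul_right ?_ hpos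
  calc _ ≤ (∑ g ∈ A.toFinset, (Finset.bipartiteAbove r (Finset.univ.erase 0) g).card) *
        Fintype.card K ^ (2 * n) := by
        refine Nat.mul_le_mul_right _ ?_
        rw [Nat.card_eq_card_toFinset]
        simpa using Finset.card_nsmul_le_sum _ _ _ hrow
    _ = ∑ v ∈ Finset.univ.erase 0, (Finset.bipartiteBelow r A.toFinset v).card *
        Fintype.card K ^ (2 * n) := by
        rw [Finset.sum_card_bipartiteAbove_eq_sum_card_bipartiteBelow, Finset.sum_mul]
    _ ≤ (Finset.univ.erase (0 : Fin (2 * n) → K)).card •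
        (2 * Fintype.card K * Nat.card (GL (Fin (2 * n)) K)) :=
        Finset.sum_le_card_nsmul _ _ _ hcol
    _ ≤ _ := by
        rw [smul_eq_mul, mul_comm]
        refine Nat.mul_le_mul_left _ ((Finset.card_erase_le).trans ?_)
        simp

end GeneralLinear

/-- There is a universal constant `C > 0` such that for every finite field `F_q`, every `n ≥ 1`
and every `c ≥ 0`, the set
`A_c = {g ∈ GL_{2n}(F_q) : g = k g₀, k ∈ Sp_{2n}(F_q), dim ker(g₀ − I) ≥ n + c}`
satisfies `|A_c| ≤ (C/q^c)·|GL_{2n}(F_q)|`. -/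
theorem card_Ac_bound :
    ∃ C : ℝ, 0 < C ∧
      ∀ (K : Type) [Field K] [Fintype K] [DecidableEq K] (n c : ℕ), 1 ≤ n →
        (Nat.card {g : GL (Fin (2 * n)) K | ∃ k g₀ : GL (Fin (2 * n)) K, InSp K k ∧
            n + c ≤ Module.finrank K (LinearMap.ker
              (Matrix.toLin' ((g₀ : Matrix (Fin (2 * n)) (Fin (2 * n)) K) - 1))) ∧
            g = k * g₀} : ℝ) ≤
          C / (Fintype.card K : ℝ) ^ c * Nat.card (GL (Fin (2 * n)) K) := by
  refine ⟨4, by norm_num, fun K _ _ _ n c hn => ?_⟩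
  rcases Nat.eq_zero_or_pos c with rfl | hc
  · have h : (Nat.card {g : GL (Fin (2 * n)) K | ∃ k g₀ : GL (Fin (2 * n)) K, InSp K k ∧
        n + 0 ≤ Module.finrank K (LinearMap.ker
          (Matrix.toLin' ((g₀ : Matrix (Fin (2 * n)) (Fin (2 * n)) K) - 1))) ∧
        g = k * g₀} : ℝ) ≤ Nat.card (GL (Fin (2 * n)) K) := by
      exact_mod_cast Nat.card_le_card_of_injective _ Subtype.val_injective
    have h₀ : (0 : ℝ) ≤ Nat.card (GL (Fin (2 * n)) K) := Nat.cast_nonneg _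
    rw [pow_zero]
    linarith
  · have h := card_mul_pow_sub_one_le (K := K) (c := c) hn
    set a := Nat.card {g : GL (Fin (2 * n)) K | ∃ k g₀ : GL (Fin (2 * n)) K, InSp K k ∧
      n + c ≤ Module.finrank K (LinearMap.ker
        (Matrix.toLin' ((g₀ : Matrix (Fin (2 * n)) (Fin (2 * n)) K) - 1))) ∧
      g = k * g₀}
    set N := Nat.card (GL (Fin (2 * n)) K)
    have hq : 1 < Fintype.card K := Fintype.one_lt_card
    set q := Fintype.card K
    have hqc : q ≤ q ^ c := Nat.le_self_pow hc.ne' q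
    have hsub : q * q ^ c ≤ 2 * (q ^ (2 * c) - 1) := by
      have h₁ : q * q ^ c ≤ q ^ (2 * c) := by
        rw [two_mul, pow_add]; exact Nat.mul_le_mul_right _ hqc
      have h₂ : 1 < q ^ (2 * c) := Nat.one_lt_pow (by omega) hq
      omega
    have hmain : a * q ^ c ≤ 4 * N := by
      refine Nat.le_of_mul_le_mul_left ?_ (zero_lt_one.trans hq)
      calc q * (a * q ^ c) = a * (q * q ^ c) := by ring
        _ ≤ a * (2 * (q ^ (2 * c) - 1)) := Nat.mul_le_mul_left _ hsub
        _ = 2 * (a * (q ^ (2 * c) - 1)) := by ring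
        _ ≤ 2 * (2 * q * N) := Nat.mul_le_mul_left _ h
        _ = q * (4 * N) := by ring
    have hpos : (0 : ℝ) < (q : ℝ) ^ c := by positivity
    rw [div_mul_eq_mul_div, le_div_iff₀ hpos]
    exact_mod_cast hmain
end
end
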